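/- Approximate Borsuk–Ulam theorem: Let n > k be positive integers and ε > 0. For any ε-continuous function f : 𝕊^{n−1} → ℝ^k (where 𝕊^{n−1} is the unit sphere in ℝ^n) satisfying f(−x) = −f(x) for all x ∈ 𝕊^{n−1}, there is a point x₀ ∈ 𝕊^{n−1} with |f(x₀)| < 2ε. -/

import Mathlib

/-- `f` is `ε`-continuous: every point has a neighborhood on which values stay
`ε`-close to the value at the point. -/
def IsEpsCont {X : Type*} [TopologicalSpace X] {Y : Type*} [PseudoMetricSpace Y]
    (ε : ℝ) (f : X → Y) : Prop :=
  ∀ p : X, ∃ U : Set X, IsOpen U ∧ p ∈ U ∧ ∀ x ∈ U, dist (f x) (f p) < ε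

namespace BU
variable {V W : Type*}

abbrev Ch (V : Type*) := List V →₀ ZMod 2

noncomputable def e (l : List V) : Ch V := Finsupp.single l 1

noncomputable def ex (g : List V → Ch W) : Ch V →ₗ[ZMod 2] Ch W :=
  Finsupp.linearCombination (ZMod 2) g

theorem ex_e (g : List V → Ch W) (l : List V) : ex g (e l) = g l := by
  simp [ex, e]

noncomputable def cn (v : V) : Ch V →ₗ[ZMod 2] Ch V := ex (fun l => e (v :: l))

theorem cn_e (v : V) (l : List V) : cn v (e l) = e (v :: l) := ex_e _ _

theorem ch_ind {P : Ch V → Prop} (x : Ch V) (h0 : P 0) (ha : ∀ x y, P x → P y → P (x + y))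
    (hs : ∀ l, P (e l)) : P x := by
  induction x using Finsupp.induction_linear with
  | zero => exact h0
  | add x y hx hy => exact ha x y hx hy
  | single l a =>
    have : a = 0 ∨ a = 1 := by revert a; decide
    rcases this with rfl | rfl
    · simpa using h0
    · exact hs l

theorem lin_ext {N : Type*} [AddCommGroup N] [Module (ZMod 2) N] (F G : Ch V →ₗ[ZMod 2] N)
    (h : ∀ l, F (e l) = G (e l)) (x : Ch V) : F x = G x := by
  induction x using ch_ind with
  | h0 => simp
  | ha x y hx hy => simp [hx, hy]
  | hs l => exact h l

theorem lin_ind {N : Type*} [AddCommGroup N] [Module (ZMod 2) N] (F G : Ch V →ₗ[ZMod 2] N)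
    (h0 : F (e []) = G (e []))
    (h : ∀ v x, F x = G x → F (cn v x) = G (cn v x)) (x : Ch V) : F x = G x := by
  apply lin_ext
  intro l
  induction l with
  | nil => exact h0
  | cons v l ih => rw [← cn_e]; exact h v _ ih

theorem ch_add_self (x : Ch V) : x + x = 0 := by
  ext l; simp [CharTwo.add_self_eq_zero]

/-! derivation -/
noncomputable def dL (w : V → ZMod 2) : List V → Ch V
  | [] => 0
  | v :: l => w v • e l + cn v (dL w l)

noncomputable def D (w : V → ZMod 2) : Ch V →ₗ[ZMod 2] Ch V := ex (dL w)

theorem D_nil (w : V → ZMod 2) : D w (e []) = 0 := by rw [D, ex_e, dL]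

theorem D_cn (w : V → ZMod 2) (v : V) (x : Ch V) : D w (cn v x) = w v • x + cn v (D w x) := by
  have := lin_ext ((D w).comp (cn v)) (w v • LinearMap.id + (cn v).comp (D w))
    (by intro l; simp [D, ex_e, cn_e, dL]) x
  simpa using this

noncomputable def mp (f : V → W) : Ch V →ₗ[ZMod 2] Ch W := ex (fun l => e (l.map f))

theorem mp_e (f : V → W) (l : List V) : mp f (e l) = e (l.map f) := ex_e _ _

theorem mp_cn (f : V → W) (v : V) (x : Ch V) : mp f (cn v x) = cn (f v) (mp f x) := by
  have := lin_ext ((mp f).comp (cn v)) ((cn (f v)).comp (mp f))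
    (by intro l; simp [cn_e, mp_e]) x
  simpa using this

noncomputable def piL (p : V → ZMod 2) : List V → Ch V
  | [] => e []
  | v :: l => p v • cn v (piL p l)

noncomputable def PI (p : V → ZMod 2) : Ch V →ₗ[ZMod 2] Ch V := ex (piL p)

theorem PI_nil (p : V → ZMod 2) : PI p (e []) = e [] := by rw [PI, ex_e, piL]

theorem PI_cn (p : V → ZMod 2) (v : V) (x : Ch V) : PI p (cn v x) = p v • cn v (PI p x) := by
  have := lin_ext ((PI p).comp (cn v)) (p v • (cn v).comp (PI p))
    (by intro l; simp [PI, ex_e, cn_e, piL]) x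
  simpa using this

noncomputable def prL (s t : V → W) : List V → Ch W
  | [] => 0
  | v :: l => cn (s v) (e ((v :: l).map t)) + cn (s v) (prL s t l)

noncomputable def P (s t : V → W) : Ch V →ₗ[ZMod 2] Ch W := ex (prL s t)

theorem P_nil (s t : V → W) : P s t (e []) = 0 := by rw [P, ex_e, prL]

theorem P_cn (s t : V → W) (v : V) (x : Ch V) :
    P s t (cn v x) = cn (s v) (cn (t v) (mp t x)) + cn (s v) (P s t x) := by
  have := lin_ext ((P s t).comp (cn v)) ((cn (s v)).comp ((cn (t v)).comp (mp t)) +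
      (cn (s v)).comp (P s t))
    (by intro l; simp [P, ex_e, cn_e, prL, mp_e]) x
  simpa using this

theorem D_D (w : V → ZMod 2) (x : Ch V) : D w (D w x) = 0 := by
  refine lin_ind ((D w).comp (D w)) 0 (by simp [D_nil]) ?_ x
  intro v x h
  simp only [LinearMap.comp_apply, LinearMap.zero_apply] at h ⊢
  rw [D_cn, map_add, map_smul, D_cn, h, map_zero, add_zero, ch_add_self]

theorem D_comm (w w' : V → ZMod 2) (x : Ch V) : D w (D w' x) = D w' (D w x) := by
  refine lin_ind ((D w).comp (D w')) ((D w').comp (D w)) (by simp [D_nil]) ?_ x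
  intro v x h
  simp only [LinearMap.comp_apply] at h ⊢
  simp only [D_cn, map_add, map_smul, h]
  abel

theorem D_add (w w' : V → ZMod 2) (x : Ch V) : D (w + w') x = D w x + D w' x := by
  refine lin_ind (D (w + w')) (D w + D w') (by simp [D_nil]) ?_ x
  intro v x h
  simp only [LinearMap.add_apply] at h ⊢
  simp only [D_cn, map_add, h, Pi.add_apply, add_smul]
  abel

theorem D_mp (f : V → W) (w : W → ZMod 2) (x : Ch V) : D w (mp f x) = mp f (D (w ∘ f) x) := by
  refine lin_ind ((D w).comp (mp f)) ((mp f).comp (D (w ∘ f))) (by simp [D_nil, mp_e]) ?_ x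
  intro v x h
  simp only [LinearMap.comp_apply] at h ⊢
  simp only [D_cn, mp_cn, map_add, map_smul, h, Function.comp]

theorem PI_mp (f : V → W) (p : W → ZMod 2) (x : Ch V) : PI p (mp f x) = mp f (PI (p ∘ f) x) := by
  refine lin_ind ((PI p).comp (mp f)) ((mp f).comp (PI (p ∘ f))) (by simp [PI_nil, mp_e]) ?_ x
  intro v x h
  simp only [LinearMap.comp_apply] at h ⊢
  simp only [PI_cn, mp_cn, map_smul, h, Function.comp]

theorem D_PI (p : V → ZMod 2) (x : Ch V) : D 1 (PI p x) = PI p (D p x) := by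
  refine lin_ind ((D 1).comp (PI p)) ((PI p).comp (D p)) (by simp [D_nil, PI_nil]) ?_ x
  intro v x h
  simp only [LinearMap.comp_apply] at h ⊢
  simp only [PI_cn, D_cn, map_smul, map_add, h, Pi.one_apply, one_smul, smul_add]

theorem mp_mp {U : Type*} (f : V → W) (g : W → U) (x : Ch V) : mp g (mp f x) = mp (g ∘ f) x := by
  refine lin_ext ((mp g).comp (mp f)) (mp (g ∘ f)) ?_ x
  intro l
  simp [mp_e]

theorem mp_id (x : Ch V) : mp id x = x := by
  refine lin_ext (mp id) LinearMap.id ?_ x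
  intro l
  simp [mp_e]

theorem P_hom (s t : V → W) (x : Ch V) :
    D 1 (P s t x) + P s t (D 1 x) = mp s x + mp t x := by
  refine lin_ind ((D 1).comp (P s t) + (P s t).comp (D 1)) (mp s + mp t)
    (by simp [P_nil, D_nil, mp_e, ch_add_self]) ?_ x
  intro v x h
  simp only [LinearMap.comp_apply, LinearMap.add_apply] at h ⊢
  have h' : P s t (D 1 x) = D 1 (P s t x) + (mp s x + mp t x) := by
    rw [← h, ← add_assoc, ch_add_self, zero_add]
  have c1 : (1 : W → ZMod 2) ∘ t = 1 := rfl
  simp only [P_cn, D_cn, mp_cn, map_add, Pi.one_apply, one_smul, h', D_mp, c1]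
  have k := fun y : Ch W => ch_add_self y
  generalize cn (t v) (mp t x) = a1
  generalize P s t x = a2
  generalize cn (s v) (mp t x) = a3
  generalize cn (s v) (cn (t v) _) = a4
  generalize cn (s v) (D 1 a2) = a5
  generalize cn (s v) _ = a6
  calc _ = a6 + a1 + (a2 + a2) + (a3 + a3) + (a4 + a4) + (a5 + a5) := by abel
    _ = _ := by simp only [k, add_zero]

theorem cf_cn (v : V) (x : Ch V) : (cn v x) [] = 0 := by
  refine lin_ext ((Finsupp.lapply []).comp (cn v)) 0 ?_ x
  intro l
  rw [LinearMap.comp_apply, cn_e]; simp [e]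

theorem cf_mp (f : V → W) (x : Ch V) : (mp f x) [] = x [] := by
  refine lin_ind ((Finsupp.lapply []).comp (mp f)) (Finsupp.lapply []) (by rw [LinearMap.comp_apply, mp_e]; simp [e]) ?_ x
  intro v x _
  simp [mp_cn, cf_cn]

theorem cf_PI (p : V → ZMod 2) (x : Ch V) : (PI p x) [] = x [] := by
  refine lin_ind ((Finsupp.lapply []).comp (PI p)) (Finsupp.lapply []) (by rw [LinearMap.comp_apply, PI_nil]) ?_ x
  intro v x _
  simp [PI_cn, cf_cn]

theorem D_zero_of (w : V → ZMod 2) (l : List V) (h : ∀ v ∈ l, w v = 0) : D w (e l) = 0 := by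
  induction l with
  | nil => exact D_nil w
  | cons v l ih =>
    rw [← cn_e, D_cn, h v (by simp), ih (fun u hu => h u (by simp [hu]))]
    simp

/-! supports -/
noncomputable def Sp (G : List V → Prop) : Submodule (ZMod 2) (Ch V) := Submodule.span (ZMod 2) {x | ∃ l, G l ∧ x = e l}

theorem e_mem {G : List V → Prop} {l : List V} (h : G l) : e l ∈ Sp G :=
  Submodule.subset_span ⟨l, h, rfl⟩

theorem Sp_map {G : List V → Prop} (S : Submodule (ZMod 2) (Ch W)) (F : Ch V →ₗ[ZMod 2] Ch W)
    (h : ∀ l, G l → F (e l) ∈ S) {x : Ch V} (hx : x ∈ Sp G) : F x ∈ S := by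
  have : Sp G ≤ S.comap F := by
    rw [Sp, Submodule.span_le]
    rintro _ ⟨l, hl, rfl⟩
    exact h l hl
  exact this hx

theorem Sp_mono {G G' : List V → Prop} (h : ∀ l, G l → G' l) {x : Ch V} (hx : x ∈ Sp G) :
    x ∈ Sp G' :=
  Sp_map (Sp G') LinearMap.id (fun l hl => e_mem (h l hl)) hx

theorem mp_mem {G : List V → Prop} {G' : List W → Prop} (f : V → W)
    (h : ∀ l, G l → G' (l.map f)) {x : Ch V} (hx : x ∈ Sp G) : mp f x ∈ Sp G' :=
  Sp_map _ _ (fun l hl => by rw [mp_e]; exact e_mem (h l hl)) hx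

theorem cn_mem {G G' : List V → Prop} (v : V)
    (h : ∀ l, G l → G' (v :: l)) {x : Ch V} (hx : x ∈ Sp G) : cn v x ∈ Sp G' :=
  Sp_map _ _ (fun l hl => by rw [cn_e]; exact e_mem (h l hl)) hx

theorem D_mem_aux (w : V → ZMod 2) (l : List V) : D w (e l) ∈ Sp (fun l' => l' ⊆ l) := by
  induction l with
  | nil => rw [D_nil]; exact zero_mem _
  | cons v l ih =>
    rw [← cn_e, D_cn]
    refine add_mem (Submodule.smul_mem _ _ (e_mem (by simp))) (cn_mem v ?_ ih)
    intro l' h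
    exact List.cons_subset_cons v h

theorem D_mem {G : List V → Prop} (hG : ∀ l l', l' ⊆ l → G l → G l') (w : V → ZMod 2)
    {x : Ch V} (hx : x ∈ Sp G) : D w x ∈ Sp G :=
  Sp_map _ _ (fun l hl => Sp_mono (fun l' h => hG l l' h hl) (D_mem_aux w l)) hx

theorem PI_mem_aux (p : V → ZMod 2) (l : List V) :
    PI p (e l) ∈ Sp (fun l' => l' = l ∧ ∀ v ∈ l, p v ≠ 0) := by
  induction l with
  | nil => rw [PI_nil]; exact e_mem (by simp)
  | cons v l ih =>
    rw [← cn_e, PI_cn]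
    by_cases hv : p v = 0
    · rw [hv, zero_smul]; exact zero_mem _
    · refine Submodule.smul_mem _ _ (cn_mem v ?_ ih)
      rintro l' ⟨rfl, h⟩
      exact ⟨rfl, by simpa [hv] using h⟩

theorem PI_mem {G G' : List V → Prop} (p : V → ZMod 2)
    (h : ∀ l, G l → (∀ v ∈ l, p v ≠ 0) → G' l)
    {x : Ch V} (hx : x ∈ Sp G) : PI p x ∈ Sp G' :=
  Sp_map _ _ (fun l hl => Sp_mono (fun l' h' => by
    obtain ⟨rfl, h'⟩ := h'; exact h _ hl h') (PI_mem_aux p l)) hx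

theorem P_mem_aux (s t : V → W) (l : List V) :
    P s t (e l) ∈ Sp (fun l' => ∀ u ∈ l', ∃ v ∈ l, u = s v ∨ u = t v) := by
  induction l with
  | nil => rw [P_nil]; exact zero_mem _
  | cons v l ih =>
    rw [← cn_e, P_cn, mp_e, cn_e, cn_e]
    refine add_mem (e_mem ?_) (cn_mem _ ?_ ih)
    · intro u hu
      simp only [List.mem_cons, List.mem_map] at hu ⊢
      rcases hu with h | h | ⟨a, ha, rfl⟩
      · exact ⟨v, by simp, Or.inl h⟩
      · exact ⟨v, by simp, Or.inr h⟩
      · exact ⟨a, by simp [ha], Or.inr rfl⟩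
    · intro l' h u hu
      simp only [List.mem_cons] at hu ⊢
      rcases hu with h' | hu
      · exact ⟨v, by simp, Or.inl h'⟩
      · obtain ⟨a, ha, h⟩ := h u hu
        exact ⟨a, by simp [ha], h⟩

theorem P_mem {G : List V → Prop} {G' : List W → Prop} (s t : V → W)
    (h : ∀ l l', G l → (∀ u ∈ l', ∃ v ∈ l, u = s v ∨ u = t v) → G' l')
    {x : Ch V} (hx : x ∈ Sp G) : P s t x ∈ Sp G' :=
  Sp_map _ _ (fun l hl => Sp_mono (fun l' h' => h l l' hl h') (P_mem_aux s t l)) hx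

/-! Tucker -/
def Good (nu : V → V) (A : ℕ → V → Prop) (k : ℕ) (l : List V) : Prop :=
  (∀ v ∈ l, ∃ j < k, A j v ∨ A j (nu v)) ∧ ∀ j, ∀ u ∈ l, ∀ v ∈ l, ¬ (A j u ∧ A j (nu v))

open Classical in
theorem tucker (nu : V → V) (hnu : ∀ v, nu (nu v) = v) (A : ℕ → V → Prop) (k : ℕ) :
    ∀ c : ℕ → Ch V, (∀ i ≤ k, c i ∈ Sp (Good nu A k)) → (D 1 (c 0)) [] = 1 →
      (∀ i < k, D 1 (c (i + 1)) = c i + mp nu (c i)) → False := by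
  induction k with
  | zero =>
    intro c hc h0 _
    have : D 1 (c 0) ∈ (⊥ : Submodule (ZMod 2) (Ch V)) := by
      refine Sp_map _ _ ?_ (hc 0 le_rfl)
      intro l hl
      cases l with
      | nil => simp [D_nil]
      | cons v l => obtain ⟨j, hj, _⟩ := hl.1 v (by simp); omega
    rw [Submodule.mem_bot] at this
    rw [this] at h0
    simp at h0
  | succ k ih =>
    intro c hc h0 h1
    let wp : V → ZMod 2 := fun v => if A k v then 1 else 0
    let wm : V → ZMod 2 := fun v => if A k (nu v) then 1 else 0
    let p : V → ZMod 2 := 1 + wp + wm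
    have hp : p ∘ nu = p := by
      funext v
      simp only [p, wp, wm, Function.comp, Pi.add_apply, Pi.one_apply, hnu]
      ring
    have hw : wp ∘ nu = wm := rfl
    have hpv : ∀ v, ¬ (A k v ∧ A k (nu v)) → p v ≠ 0 → ¬ A k v ∧ ¬ A k (nu v) := by
      intro v h h'
      by_cases a : A k v <;> by_cases b : A k (nu v) <;>
        simp_all [p, wp, wm, CharTwo.add_self_eq_zero]
    have hmm : ∀ x : Ch V, mp nu (mp nu x) = x := by
      intro x
      rw [mp_mp, show nu ∘ nu = id from funext hnu, mp_id]
    have hPm : ∀ x : Ch V, PI p (mp nu x) = mp nu (PI p x) := by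
      intro x; rw [PI_mp, hp]
    have hDm : ∀ x : Ch V, D wp (mp nu x) = mp nu (D wm x) := by
      intro x; rw [D_mp, hw]
    have hdm : ∀ x : Ch V, D 1 (mp nu x) = mp nu (D 1 x) := by
      intro x; rw [D_mp]; rfl
    have hdP : ∀ x : Ch V, D 1 (PI p x) = PI p (D 1 x) + PI p (D wp x) + PI p (D wm x) := by
      intro x
      rw [D_PI, D_add, D_add, map_add, map_add]
    have hpm : ∀ x ∈ Sp (Good nu A (k + 1)), D wm (D wp x) = 0 := by
      intro x hx
      have : ((D wm).comp (D wp)) x ∈ (⊥ : Submodule (ZMod 2) (Ch V)) := by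
        refine Sp_map _ _ ?_ hx
        intro l hl
        rw [Submodule.mem_bot, LinearMap.comp_apply]
        by_cases h : ∃ u ∈ l, A k u
        · obtain ⟨u, hu, hA⟩ := h
          rw [D_comm, D_zero_of wm, map_zero]
          intro v hv
          simp only [wm, ite_eq_right_iff]
          intro h
          exact absurd ⟨hA, h⟩ (hl.2 k u hu v hv)
        · push Not at h
          rw [D_zero_of wp, map_zero]
          intro v hv
          simp [wp, h v hv]
      simpa using this
    have hdPD : ∀ x ∈ Sp (Good nu A (k + 1)), D 1 (PI p (D wp x)) = PI p (D wp (D 1 x)) := by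
      intro x hx
      rw [hdP, D_D, hpm x hx, D_comm]; simp
    have key : ∀ i ≤ k, D 1 (PI p (D wp (c (i+1))) + mp nu (PI p (c i))) =
        PI p (D wp (c i)) + mp nu (PI p (D wp (c i))) + mp nu (PI p (D 1 (c i))) := by
      intro i hi
      rw [map_add, hdPD _ (hc _ (by omega)), h1 i (by omega), hdm, hdP]
      simp only [map_add, hDm, hPm]
      generalize mp nu (PI p (D wm (c i))) = a
      calc _ = PI p (D wp (c i)) + mp nu (PI p (D wp (c i))) + mp nu (PI p (D 1 (c i))) + (a + a) := by
            abel
        _ = _ := by rw [ch_add_self, add_zero]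
    have hgPI : ∀ x ∈ Sp (Good nu A (k+1)), PI p x ∈ Sp (Good nu A k) := by
      intro x hx
      refine PI_mem p ?_ hx
      intro l hl h
      refine ⟨fun v hv => ?_, hl.2⟩
      obtain ⟨j, hj, hA⟩ := hl.1 v hv
      have := hpv v (hl.2 k v hv v hv) (h v hv)
      refine ⟨j, ?_, hA⟩
      rcases Nat.lt_succ_iff_lt_or_eq.1 hj with h | rfl
      · exact h
      · tauto
    refine ih (fun i => PI p (D wp (c (i+1))) + mp nu (PI p (c i))) ?_ ?_ ?_
    · intro i hi
      refine add_mem (hgPI _ (D_mem ?_ wp (hc _ (by omega)))) (mp_mem nu ?_ (hgPI _ (hc _ (by omega))))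
      · intro l l' hs hl
        exact ⟨fun v hv => hl.1 v (hs hv), fun j u hu v hv => hl.2 j u (hs hu) v (hs hv)⟩
      · intro l hl
        refine ⟨?_, ?_⟩
        · intro v hv
          obtain ⟨u, hum, rfl⟩ := List.mem_map.1 hv
          obtain ⟨j, hj, h⟩ := hl.1 u hum
          exact ⟨j, hj, by rw [hnu]; exact h.symm⟩
        · intro j u hu v hv
          obtain ⟨u, hum, rfl⟩ := List.mem_map.1 hu
          obtain ⟨v, hvm, rfl⟩ := List.mem_map.1 hv
          rw [hnu]
          exact fun h => hl.2 j v hvm u hum h.symm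
    · rw [key 0 (by omega)]
      simp only [Finsupp.add_apply, cf_mp, cf_PI, h0, CharTwo.add_self_eq_zero, zero_add]
    · intro i hi
      rw [key (i+1) (by omega), h1 i (by omega)]
      simp only [map_add, hPm, hmm]
      abel

/-! fine chains on the sphere -/
section sphere
variable {n : ℕ}

local notation "E" => EuclideanSpace ℝ (Fin n)

def Fine (η : ℝ) (i : ℕ) (l : List (EuclideanSpace ℝ (Fin n))) : Prop :=
  (∀ u ∈ l, ‖u‖ = 1 ∧ ∀ j : Fin n, i < j → u j = 0) ∧ ∀ u ∈ l, ∀ v ∈ l, dist u v ≤ i * η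

noncomputable def rot (a : EuclideanSpace ℝ (Fin n)) (θ : ℝ) (x : EuclideanSpace ℝ (Fin n)) : EuclideanSpace ℝ (Fin n) :=
  Real.cos θ • x + Real.sin θ • a

theorem rot_dist (a : E) (θ : ℝ) (x y : E) : dist (rot a θ x) (rot a θ y) ≤ dist x y := by
  rw [dist_eq_norm, dist_eq_norm, rot, rot, add_sub_add_right_eq_sub, ← smul_sub, norm_smul]
  have := Real.abs_cos_le_one θ
  rw [Real.norm_eq_abs]
  nlinarith [norm_nonneg (x - y)]

theorem rot_dist2 (a : E) (ha : ‖a‖ = 1) (θ θ' : ℝ) (x : E) (hx : ‖x‖ = 1) :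
    dist (rot a θ x) (rot a θ' x) ≤ 2 * |θ - θ'| := by
  have h : rot a θ x - rot a θ' x = (Real.cos θ - Real.cos θ') • x + (Real.sin θ - Real.sin θ') • a := by
    simp only [rot, sub_smul]; abel
  rw [dist_eq_norm, h]
  refine (norm_add_le _ _).trans ?_
  rw [norm_smul, norm_smul, ha, hx, Real.norm_eq_abs, Real.norm_eq_abs]
  have h1 : |Real.cos θ - Real.cos θ'| ≤ |θ - θ'| := by
    simpa [Real.dist_eq] using Real.lipschitzWith_cos.dist_le_mul θ θ'
  have h2 : |Real.sin θ - Real.sin θ'| ≤ |θ - θ'| := by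
    simpa [Real.dist_eq] using Real.lipschitzWith_sin.dist_le_mul θ θ'
  linarith

theorem rot_norm (i : Fin n) (θ : ℝ) (x : E) (hx : ‖x‖ = 1) (hi : x i = 0) :
    ‖rot (EuclideanSpace.single i 1) θ x‖ = 1 := by
  have h : ‖rot (EuclideanSpace.single i 1) θ x‖ * ‖rot (EuclideanSpace.single i 1) θ x‖ = 1 := by
    rw [rot, norm_add_sq_eq_norm_sq_add_norm_sq_real]
    · simp only [norm_smul, hx, Real.norm_eq_abs, EuclideanSpace.norm_single, norm_one, abs_one, mul_one, abs_mul_abs_self]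
      nlinarith [Real.sin_sq_add_cos_sq θ]
    · simp [inner_smul_left, inner_smul_right, EuclideanSpace.inner_single_right, hi]
  nlinarith [norm_nonneg (rot (EuclideanSpace.single i 1) θ x)]

theorem chains (η : ℝ) (hη : 0 < η) (m : ℕ) (hm : m < n) :
    ∃ c : ℕ → Ch E, (∀ i ≤ m, c i ∈ Sp (Fine η i)) ∧ D 1 (c 0) = e [] ∧
      ∀ i < m, D 1 (c (i + 1)) = c i + mp (fun x => -x) (c i) := by
  induction m with
  | zero =>
    refine ⟨fun _ => e [EuclideanSpace.single ⟨0, hm⟩ 1], ?_, ?_, by simp⟩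
    · intro i hi
      obtain rfl : i = 0 := by omega
      refine e_mem ⟨?_, ?_⟩
      · intro u hu
        simp only [List.mem_singleton] at hu
        subst hu
        refine ⟨by simp, ?_⟩
        intro j hj
        have : j ≠ ⟨0, hm⟩ := by rintro rfl; simp at hj
        simp [this]
      · intro u hu v hv
        simp only [List.mem_singleton] at hu hv
        simp [hu, hv]
    · simp only
      rw [← cn_e, D_cn, D_nil]; simp
  | succ m ih =>
    obtain ⟨c, hc, h0, h1⟩ := ih (by omega)
    let a : E := EuclideanSpace.single ⟨m+1, hm⟩ 1
    obtain ⟨N, hN⟩ := exists_nat_gt (2 * (Real.pi / 2) / η)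
    have hN0 : (0 : ℝ) < N := lt_trans (by positivity) hN
    let s : ℕ → E → E := fun t => rot a (t * (Real.pi / 2 / N))
    let z : Ch E := c m + mp (fun x => -x) (c m)
    have hnn : ∀ x : Ch E, mp (fun x => -x) (mp (fun x => -x) x) = x := by
      intro x
      rw [mp_mp, show ((fun x : E => -x) ∘ fun x => -x) = id from funext neg_neg, mp_id]
    have hz0 : D 1 z = 0 := by
      have : D 1 z = D 1 (c m) + mp (fun x => -x) (D 1 (c m)) := by
        simp only [z, map_add]
        rw [D_mp]; rfl
      rw [this]
      rcases m with _ | m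
      · rw [h0, mp_e]; exact ch_add_self _
      · rw [h1 m (by omega), map_add, hnn, add_comm (mp _ _)]; exact ch_add_self _
    have hzF : z ∈ Sp (Fine η m) := by
      refine add_mem (hc m le_rfl) (mp_mem _ ?_ (hc m le_rfl))
      intro l hl
      refine ⟨?_, ?_⟩
      · intro u hu
        obtain ⟨u, hum, rfl⟩ := List.mem_map.1 hu
        simpa using hl.1 u hum
      · intro u hu v hv
        obtain ⟨u, hum, rfl⟩ := List.mem_map.1 hu
        obtain ⟨v, hvm, rfl⟩ := List.mem_map.1 hv
        simpa using hl.2 u hum v hvm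
    have hs0 : mp (s 0) z = z := by
      have : s 0 = id := by funext x; simp [s, rot]
      rw [this, mp_id]
    have hsN : mp (s N) z = 0 := by
      have : s N = fun _ => a := by
        funext x
        have : (N : ℝ) * (Real.pi / 2 / N) = Real.pi / 2 := by field_simp
        simp [s, rot, this]
      rw [this]
      simp only [z, map_add, mp_mp]
      exact ch_add_self _
    have hsum : ∀ T : ℕ, D 1 (∑ t ∈ Finset.range T, P (s t) (s (t+1)) z) = mp (s T) z + z := by
      intro T
      induction T with
      | zero => simp [hs0, ch_add_self]
      | succ T ihT =>
        have := P_hom (s T) (s (T+1)) z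
        rw [hz0, map_zero, add_zero] at this
        rw [Finset.sum_range_succ, map_add, ihT, this]
        calc _ = mp (s (T+1)) z + z + (mp (s T) z + mp (s T) z) := by abel
          _ = _ := by rw [ch_add_self, add_zero]
    refine ⟨fun i => if i ≤ m then c i else ∑ t ∈ Finset.range N, P (s t) (s (t+1)) z, ?_, ?_, ?_⟩
    · intro i hi
      by_cases him : i ≤ m
      · simp only [him, if_true]; exact hc i him
      · obtain rfl : i = m + 1 := by omega
        simp only [him, if_false]
        refine sum_mem fun t _ => P_mem _ _ ?_ hzF
        intro l l' hl h
        have hstep : ∀ v ∈ l, dist (s t v) (s (t+1) v) ≤ η := by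
          intro v hv
          refine (rot_dist2 a (by simp [a]) _ _ v (hl.1 v hv).1).trans ?_
          have : (t : ℝ) * (Real.pi / 2 / N) - ((t + 1 : ℕ) : ℝ) * (Real.pi / 2 / N) = - (Real.pi / 2 / N) := by
            push_cast; ring
          rw [this, abs_neg, abs_of_nonneg (by positivity)]
          rw [div_lt_iff₀ hη] at hN
          rw [← mul_div_assoc, div_le_iff₀ hN0]
          linarith
        have hk : ∀ t', ∀ u ∈ l, ∀ v ∈ l, dist (s t' u) (s t' v) ≤ m * η := fun t' u hu v hv =>
          (rot_dist a _ u v).trans (hl.2 u hu v hv)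
        refine ⟨?_, ?_⟩
        · have : ∀ t', ∀ v ∈ l, ‖s t' v‖ = 1 ∧ ∀ j : Fin n, m + 1 < (j : ℕ) → s t' v j = 0 := by
            intro t' v hv
            refine ⟨rot_norm _ _ _ (hl.1 v hv).1 ((hl.1 v hv).2 _ (by simp)), ?_⟩
            intro j hj
            have h2 : j ≠ ⟨m+1, hm⟩ := by rintro rfl; simp at hj
            simp [s, rot, a, (hl.1 v hv).2 j (by omega), h2]
          intro u hu
          obtain ⟨v, hv, rfl | rfl⟩ := h u hu
          · exact this _ v hv
          · exact this _ v hv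
        · intro u hu v hv
          push_cast
          obtain ⟨x, hx, hx'⟩ := h u hu
          obtain ⟨y, hy, hy'⟩ := h v hv
          have k1 := hk t x hx y hy
          have k2 := hk (t+1) x hx y hy
          have k3 := hstep x hx
          have k4 := hstep y hy
          rcases hx' with rfl | rfl <;> rcases hy' with rfl | rfl
          · linarith
          · linarith [dist_triangle (s t x) (s t y) (s (t+1) y)]
          · linarith [dist_triangle (s (t+1) x) (s t x) (s t y), dist_comm (s t x) (s (t+1) x)]
          · linarith
    · simpa using h0
    · intro i hi
      by_cases him : i + 1 ≤ m
      · simp only [him, if_true, show i ≤ m by omega]; exact h1 i him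
      · obtain rfl : i = m := by omega
        simp only [him, if_false, le_refl, if_true]
        rw [hsum, hsN, zero_add]

end sphere
end BU

/-- Approximate Borsuk–Ulam. Let `n > k ≥ 1` and `ε > 0`.  Any
`ε`-continuous odd map `f : 𝕊^{n-1} → ℝ^k` takes a value of norm `< 2ε` somewhere. -/
theorem stmt9 (n k : ℕ) (hk : 0 < k) (hnk : k < n) (ε : ℝ) (hε : 0 < ε)
    (f : Metric.sphere (0 : EuclideanSpace ℝ (Fin n)) 1 → EuclideanSpace ℝ (Fin k))
    (hf : IsEpsCont ε f)
    (hodd : ∀ x : Metric.sphere (0 : EuclideanSpace ℝ (Fin n)) 1, f (-x) = -f x) :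
    ∃ x₀ : Metric.sphere (0 : EuclideanSpace ℝ (Fin n)) 1, ‖f x₀‖ < 2 * ε := by
  by_contra! hcon
  obtain ⟨g, hg⟩ := exists_continuous_forall_mem_convex_of_local_const
    (t := fun x => Metric.ball (f x) ε) (fun x => convex_ball _ _) (by
      intro p
      obtain ⟨U, hU, hp, h⟩ := hf p
      refine ⟨f p, ?_⟩
      filter_upwards [hU.mem_nhds hp] with y hy
      rw [Metric.mem_ball, dist_comm]
      exact h y hy)
  let h : Metric.sphere (0 : EuclideanSpace ℝ (Fin n)) 1 → EuclideanSpace ℝ (Fin k) :=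
    fun x => (1/2 : ℝ) • (g x - g (-x))
  have hcont : Continuous h := by
    have := g.continuous
    fun_prop
  have hho : ∀ x, h (-x) = - h x := by
    intro x
    simp only [h, neg_neg]
    rw [← smul_neg, neg_sub]
  have hbig : ∀ x, ε < ‖h x‖ := by
    intro x
    have h1 := hg x
    have h2 := hg (-x)
    rw [mem_ball_iff_norm] at h1 h2
    have e1 : f x = h x - (1/2 : ℝ) • ((g x - f x) - (g (-x) - f (-x))) := by
      rw [hodd]; simp only [h]; module
    have h3 := hcon x
    have h4 : ‖(1/2 : ℝ) • ((g x - f x) - (g (-x) - f (-x)))‖ < ε := by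
      rw [norm_smul]
      have := norm_sub_le (g x - f x) (g (-x) - f (-x))
      norm_num at this ⊢
      linarith
    have h5 := norm_sub_le (h x) ((1/2 : ℝ) • ((g x - f x) - (g (-x) - f (-x))))
    rw [← e1] at h5
    linarith
  have hk' : (0 : ℝ) < k := by exact_mod_cast hk
  let δ := ε / k
  have hδ : 0 < δ := by positivity
  have hcoord : ∀ x, ∃ j, δ < |h x j| := by
    intro x
    by_contra! hx
    have : ‖h x‖ ≤ ε := by
      have h1 : ‖h x‖ ^ 2 ≤ ε ^ 2 := by
        rw [EuclideanSpace.norm_sq_eq]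
        calc ∑ i, ‖h x i‖ ^ 2 ≤ ∑ i : Fin k, δ ^ 2 := by
              refine Finset.sum_le_sum fun i _ => ?_
              rw [Real.norm_eq_abs]
              exact pow_le_pow_left₀ (abs_nonneg _) (hx i) 2
          _ = k * δ ^ 2 := by simp
          _ ≤ (k * δ) ^ 2 := by
              have : (1 : ℝ) ≤ k := by exact_mod_cast hk
              rw [mul_pow]
              refine mul_le_mul_of_nonneg_right ?_ (by positivity)
              nlinarith
          _ = ε ^ 2 := by simp only [δ]; field_simp
      exact (le_abs_self _).trans (abs_le_of_sq_le_sq h1 hε.le)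
    linarith [hbig x]
  have huc : UniformContinuous h := CompactSpace.uniformContinuous_of_continuous hcont
  obtain ⟨η, hη, hu⟩ := Metric.uniformContinuous_iff.1 huc δ hδ
  have hn0 : (0 : ℝ) < n := by exact_mod_cast (by omega : 0 < n)
  obtain ⟨c, hc, h0, h1⟩ := BU.chains (n := n) (η / n) (by positivity) k hnk
  let A : ℕ → EuclideanSpace ℝ (Fin n) → Prop := fun j x =>
    ∃ (hx : x ∈ Metric.sphere (0 : EuclideanSpace ℝ (Fin n)) 1) (hj : j < k), δ < h ⟨x, hx⟩ ⟨j, hj⟩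
  refine BU.tucker (fun x => -x) neg_neg A k c ?_ (by rw [h0]; simp [BU.e]) h1
  intro i hi
  refine BU.Sp_mono ?_ (hc i hi)
  intro l hl
  refine ⟨?_, ?_⟩
  · intro v hv
    have hv1 : v ∈ Metric.sphere (0 : EuclideanSpace ℝ (Fin n)) 1 := by simpa using (hl.1 v hv).1
    obtain ⟨j, hj⟩ := hcoord ⟨v, hv1⟩
    refine ⟨j, j.2, ?_⟩
    rcases lt_abs.1 hj with hj | hj
    · exact Or.inl ⟨hv1, j.2, hj⟩
    · refine Or.inr ⟨by simpa using hv1, j.2, ?_⟩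
      have := hho ⟨v, hv1⟩
      have e2 : h ⟨-v, by simpa using hv1⟩ = - h ⟨v, hv1⟩ := this
      rw [e2]
      simpa using hj
  · rintro j u hu' v hv ⟨⟨hu1, hj, hA⟩, ⟨hv1, _, hB⟩⟩
    have hv2 : v ∈ Metric.sphere (0 : EuclideanSpace ℝ (Fin n)) 1 := by simpa using (hl.1 v hv).1
    have e2 : h ⟨-v, hv1⟩ = - h ⟨v, hv2⟩ := hho ⟨v, hv2⟩
    rw [e2] at hB
    have hd : dist u v < η := by
      refine (hl.2 u hu' v hv).trans_lt ?_
      have : (i : ℝ) < n := by exact_mod_cast (by omega : i < n)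
      rw [← mul_div_assoc, div_lt_iff₀ hn0]
      nlinarith
    have hd2 := @hu ⟨u, hu1⟩ ⟨v, hv2⟩ hd
    rw [dist_eq_norm] at hd2
    have hd3 := (PiLp.norm_apply_le (h ⟨u, hu1⟩ - h ⟨v, hv2⟩) ⟨j, hj⟩).trans_lt hd2
    rw [Real.norm_eq_abs] at hd3
    have hd4 := (abs_lt.1 hd3).2
    simp only [PiLp.sub_apply, PiLp.neg_apply] at hd4 hB
    linarith
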